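/- Let k be an algebraically closed field of characteristic ≠ 2 and let J be a Jordan superalgebra over k with dim J₀ = 2, dim J₁ = 1, such that J₀ has a basis {e₁, e₂} with e₁² = e₁, e₁e₂ = e₂, e₂² = 0 (J₀ is the Jordan algebra B₁). Then, writing J₁ = k·o₁, J is isomorphic as a ℤ/2-graded algebra to exactly one of: (i) B₁ˢ ⊕ S₁¹: e₁o₁ = e₂o₁ = 0; (ii) S₉³: e₁o₁ = (1/2)o₁, e₂o₁ = 0; (iii) S₁₀³: e₁o₁ = o₁, e₂o₁ = 0. -/

import Mathlib

/-- The sign `(-1)^{|a||b|}` as an element of the field `K`. -/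
def sgn (K : Type*) [Field K] (x y : Bool) : K := if x && y then -1 else 1

/-- A Jordan superalgebra over a field `K`: a `K`-vector space with a bilinear
multiplication, a `ℤ/2`-grading `J = J0 ⊕ J1`, super-commutativity and the super
Jordan identity on homogeneous elements. Parity `false` = even, `true` = odd. -/
structure JordanSuperalgebra (K : Type*) [Field K] (J : Type*) [AddCommGroup J]
    [Module K J] where
  mul : J →ₗ[K] J →ₗ[K] J
  J0 : Submodule K J
  J1 : Submodule K J
  compl : IsCompl J0 J1
  grade : ∀ pa pb : Bool, ∀ a ∈ cond pa J1 J0, ∀ b ∈ cond pb J1 J0,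
    mul a b ∈ cond (xor pa pb) J1 J0
  supercomm : ∀ pa pb : Bool, ∀ a ∈ cond pa J1 J0, ∀ b ∈ cond pb J1 J0,
    mul a b = sgn K pa pb • mul b a
  superJordan : ∀ pa pb pc pd : Bool,
    ∀ a ∈ cond pa J1 J0, ∀ b ∈ cond pb J1 J0, ∀ c ∈ cond pc J1 J0, ∀ d ∈ cond pd J1 J0,
    mul (mul a b) (mul c d) + sgn K pb pc • mul (mul a c) (mul b d)
        + (sgn K pb pd * sgn K pc pd) • mul (mul a d) (mul b c)
      = mul (mul (mul a b) c) d + (sgn K pc pd * sgn K pb pc) • mul (mul (mul a d) c) b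
        + (sgn K pa pb * sgn K pa pc * sgn K pa pd * sgn K pc pd) • mul (mul (mul b d) c) a

/-- A left identity on a generating pair is a left identity on its span. -/
lemma mul_eq_of_mem_span_pair {K J : Type*} [Field K] [AddCommGroup J] [Module K J]
    {φ : J →ₗ[K] J} {x y z : J} (hx : φ x = x) (hy : φ y = y)
    (hz : z ∈ Submodule.span K {x, y}) : φ z = z := by
  obtain ⟨a, b, rfl⟩ := Submodule.mem_span_pair.1 hz
  simp [hx, hy]

namespace JordanSuperalgebra

variable {K J : Type*} [Field K] [AddCommGroup J] [Module K J] (S : JordanSuperalgebra K J)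

lemma mul_odd_even {x w : J} (hx : x ∈ S.J0) (hw : w ∈ S.J1) : S.mul w x = S.mul x w := by
  simpa [sgn] using S.supercomm true false w hw x hx

lemma mul_self_odd (h2 : (2 : K) ≠ 0) {w : J} (hw : w ∈ S.J1) : S.mul w w = 0 := by
  have h : S.mul w w = -S.mul w w := by
    simpa [sgn] using S.supercomm true true w hw w hw
  have h' : (2 : K) • S.mul w w = 0 := by
    rw [two_smul]
    nth_rewrite 1 [h]
    exact neg_add_cancel _
  exact (smul_eq_zero.1 h').resolve_left h2

/-- The Peirce eigenvalues of an even idempotent on an odd eigenvector. -/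
lemma eigenvalue_idempotent {x w : J} {b : K} (hx : x ∈ S.J0) (hw : w ∈ S.J1) (hw0 : w ≠ 0)
    (hxx : S.mul x x = x) (hb : S.mul x w = b • w) : b = 0 ∨ 2 * b = 1 ∨ b = 1 := by
  have h := S.superJordan false false false true x hx x hx x hx w hw
  have hwx := (S.mul_odd_even hx hw).trans hb
  simp only [sgn, Bool.and_false, Bool.and_true, Bool.false_eq_true, if_false, one_mul,
    hxx, hb, hwx, map_smul, LinearMap.smul_apply, smul_smul, ← add_smul] at h
  have h' := smul_left_injective K hw0 h
  have h'' : b * ((2 * b - 1) * (b - 1)) = 0 := by linear_combination -h'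
  rcases mul_eq_zero.1 h'' with h | h
  · exact Or.inl h
  rcases mul_eq_zero.1 h with h | h
  · exact Or.inr (Or.inl (sub_eq_zero.1 h))
  · exact Or.inr (Or.inr (sub_eq_zero.1 h))

/-- An even element of square zero kills its odd eigenvectors. -/
lemma eigenvalue_sq_zero (h2 : (2 : K) ≠ 0) {x w : J} {c : K} (hx : x ∈ S.J0) (hw : w ∈ S.J1)
    (hw0 : w ≠ 0) (hxx : S.mul x x = 0) (hc : S.mul x w = c • w) : c = 0 := by
  have h := S.superJordan false false false true x hx x hx x hx w hw
  have hwx := (S.mul_odd_even hx hw).trans hc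
  simp only [sgn, Bool.and_false, Bool.and_true, Bool.false_eq_true, if_false, one_mul,
    hxx, hc, hwx, map_smul, LinearMap.smul_apply, smul_smul, map_zero, LinearMap.zero_apply,
    smul_zero, add_zero, zero_add, ← add_smul] at h
  have h' := (smul_eq_zero.1 h.symm).resolve_right hw0
  have h'' : 2 * c ^ 3 = 0 := by linear_combination h'
  exact pow_eq_zero_iff (by norm_num) |>.1 ((mul_eq_zero.1 h'').resolve_left h2)

end JordanSuperalgebra

/-- Classification of Jordan superalgebras of type `(2,1)` whose even
part is `B₁` (`e₁² = e₁`, `e₁e₂ = e₂`, `e₂² = 0`), over an algebraically closed field of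
characteristic ≠ 2: exactly one of the tables `e₁o₁ = β·o₁`, `e₂o₁ = 0` with
`β ∈ {0, 1/2, 1}` is realized by a homogeneous basis. -/
theorem classification_type_two_one_B1 (K : Type) [Field K] [IsAlgClosed K]
    (h2 : (2 : K) ≠ 0)
    (J : Type) [AddCommGroup J] [Module K J] (S : JordanSuperalgebra K J)
    (e₁ e₂ o₁ : J)
    (hJ0 : S.J0 = Submodule.span K {e₁, e₂}) (hli : LinearIndependent K ![e₁, e₂])
    (hJ1 : S.J1 = Submodule.span K {o₁}) (ho : o₁ ≠ 0)
    (h11 : S.mul e₁ e₁ = e₁) (h12 : S.mul e₁ e₂ = e₂)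
    (h21 : S.mul e₂ e₁ = e₂) (h22 : S.mul e₂ e₂ = 0) :
    ∃! p : Fin 3, ∃ f₁ f₂ w : J,
      S.J0 = Submodule.span K {f₁, f₂} ∧ LinearIndependent K ![f₁, f₂] ∧
      S.J1 = Submodule.span K {w} ∧ w ≠ 0 ∧
      S.mul f₁ f₁ = f₁ ∧ S.mul f₁ f₂ = f₂ ∧ S.mul f₂ f₁ = f₂ ∧ S.mul f₂ f₂ = 0 ∧
      S.mul f₁ w = (![(0 : K), 1/2, 1] p) • w ∧
      S.mul w f₁ = (![(0 : K), 1/2, 1] p) • w ∧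
      S.mul f₂ w = 0 ∧ S.mul w f₂ = 0 ∧ S.mul w w = 0 := by
  have he₁ : e₁ ∈ S.J0 := hJ0 ▸ Submodule.subset_span (by simp)
  have he₂ : e₂ ∈ S.J0 := hJ0 ▸ Submodule.subset_span (by simp)
  have ho₁ : o₁ ∈ S.J1 := hJ1 ▸ Submodule.subset_span (by simp)
  have heig : ∀ x ∈ S.J0, ∃ b : K, S.mul x o₁ = b • o₁ := by
    intro x hx
    have h : S.mul x o₁ ∈ S.J1 := S.grade false true x hx o₁ ho₁
    rw [hJ1] at h
    obtain ⟨b, hb⟩ := Submodule.mem_span_singleton.1 h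
    exact ⟨b, hb.symm⟩
  obtain ⟨b, hb⟩ := heig e₁ he₁
  obtain ⟨c, hc⟩ := heig e₂ he₂
  obtain rfl := S.eigenvalue_sq_zero h2 he₂ ho₁ ho h22 hc
  rw [zero_smul] at hc
  have hp : ∃ p : Fin 3, ![(0 : K), 1/2, 1] p = b := by
    rcases S.eigenvalue_idempotent he₁ ho₁ ho h11 hb with h | h | h
    · exact ⟨0, by simp [h]⟩
    · refine ⟨1, ?_⟩
      simp only [Matrix.cons_val]
      rw [div_eq_iff h2]
      linear_combination -h
    · exact ⟨2, by simp [h]⟩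
  have hinj : Function.Injective ![(0 : K), 1/2, 1] := by
    have h12' : (2 : K)⁻¹ ≠ 1 := by
      intro h
      have h' := inv_eq_one.1 h
      exact one_ne_zero (α := K) (by linear_combination h')
    intro p q hpq
    fin_cases p <;> fin_cases q <;> simp [h2, h12', h12'.symm, eq_comm (a := (0 : K))] at hpq ⊢
  obtain ⟨p, rfl⟩ := hp
  refine ⟨p, ⟨e₁, e₂, o₁, hJ0, hli, hJ1, ho, h11, h12, h21, h22, hb,
    (S.mul_odd_even he₁ ho₁).trans hb, hc, (S.mul_odd_even he₂ ho₁).trans hc,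
    S.mul_self_odd h2 ho₁⟩, ?_⟩
  rintro q ⟨f₁, f₂, w, hf0, -, hf1, hw, hf11, hf12, -, -, hfw, -⟩
  have hf₁ : f₁ ∈ S.J0 := hf0 ▸ Submodule.subset_span (by simp)
  have hwJ : w ∈ S.J1 := hf1 ▸ Submodule.subset_span (by simp)
  have hfe : f₁ = e₁ :=
    (mul_eq_of_mem_span_pair (φ := S.mul.flip e₁) h11 h21 (hJ0 ▸ hf₁)).symm.trans
      (mul_eq_of_mem_span_pair hf11 hf12 (hf0 ▸ he₁))
  rw [hJ1] at hwJ
  obtain ⟨a, rfl⟩ := Submodule.mem_span_singleton.1 hwJ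
  rw [hfe, map_smul, hb, smul_comm] at hfw
  exact hinj (smul_left_injective K hw hfw).symm
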